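/- Imperfect world models are exploitable: fix a finite task (S, A, d0, R, γ) with γ ∈ [0,1) and let Π be a set of stationary policies containing a nonempty subset open in Π^+. If T and T' are transition models such that neither J_T nor J_{T'} is constant on Π, and J_T, J_{T'} do not induce the same ordering on Π, then (T, T') is exploitable on Π: there exist π, π' ∈ Π with J_T(π) > J_T(π') and J_{T'}(π') > J_{T'}(π). -/

import Mathlib

open Matrix

/-- `p` is a probability distribution on the finite set `S`. -/
def IsDist {S : Type*} [Fintype S] (p : S → ℝ) : Prop :=
  (∀ s, 0 ≤ p s) ∧ ∑ s, p s = 1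

/-- `π` is a stationary policy: each `π s` is a distribution over actions. -/
def IsPolicy {S A : Type*} [Fintype A] (π : S → A → ℝ) : Prop :=
  ∀ s, (∀ a, 0 ≤ π s a) ∧ ∑ a, π s a = 1

/-- `T` is a transition model: each `T s a` is a distribution over next states. -/
def IsTransModel {S A : Type*} [Fintype S] (T : S → A → S → ℝ) : Prop :=
  ∀ s a, (∀ s', 0 ≤ T s a s') ∧ ∑ s', T s a s' = 1

/-- The policy-induced transition matrix `P^π(s,s') = Σ_a π(a|s) T(s'|s,a)`. -/
noncomputable def Pmat {S A : Type*} [Fintype A] (T : S → A → S → ℝ)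
    (π : S → A → ℝ) : Matrix S S ℝ :=
  Matrix.of fun s s' => ∑ a, π s a * T s a s'

/-- The policy-induced expected reward vector `r^π(s) = Σ_a π(a|s) R(s,a)`. -/
noncomputable def rvec {S A : Type*} [Fintype A] (R : S → A → ℝ)
    (π : S → A → ℝ) : S → ℝ :=
  fun s => ∑ a, π s a * R s a

/-- The policy value `J(π) = Σ_s d0(s) V^π(s)` with `V^π = (I - γ P^π)⁻¹ r^π`. -/
noncomputable def Jval {S A : Type*} [Fintype S] [Fintype A] [DecidableEq S]
    (T : S → A → S → ℝ) (R : S → A → ℝ) (d0 : S → ℝ) (γ : ℝ)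
    (π : S → A → ℝ) : ℝ :=
  ∑ s, d0 s * (((1 : Matrix S S ℝ) - γ • Pmat T π)⁻¹ *ᵥ rvec R π) s

/-- Discounted visit counts `F^π(s,a) = μ^π(s) π(a|s)` with
`μ^π = (I - γ (P^π)ᵀ)⁻¹ d0`. -/
noncomputable def visitCount {S A : Type*} [Fintype S] [Fintype A] [DecidableEq S]
    (T : S → A → S → ℝ) (d0 : S → ℝ) (γ : ℝ) (π : S → A → ℝ) :
    S → A → ℝ :=
  fun s a => ((((1 : Matrix S S ℝ) - γ • (Pmat T π)ᵀ)⁻¹) *ᵥ d0) s * π s a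

/-- The policy value written as the inner product `J(π) = ⟨R, F^π⟩`. -/
noncomputable def JvisF {S A : Type*} [Fintype S] [Fintype A] [DecidableEq S]
    (T : S → A → S → ℝ) (R : S → A → ℝ) (d0 : S → ℝ) (γ : ℝ)
    (π : S → A → ℝ) : ℝ :=
  ∑ s, ∑ a, R s a * visitCount T d0 γ π s a

/-- The interior `Π⁺` of the policy space: policies with all entries positive. -/
def PiPlus {S A : Type*} [Fintype A] : Set (S → A → ℝ) :=
  {π | IsPolicy π ∧ ∀ s a, 0 < π s a}

open Filter Topology

section Comonotone

variable {E : Type*} [NormedAddCommGroup E] [NormedSpace ℝ E]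

/-- Any two points of `X` are joined by an analytic curve in `X` along which `f` is affine. -/
def HasAffineCurves (X : Set E) (f : E → ℝ) : Prop :=
  ∀ p ∈ X, ∀ q ∈ X, ∃ c : ℝ → E, c 0 = p ∧ c 1 = q ∧ ∀ t ∈ Set.Icc (0 : ℝ) 1,
    c t ∈ X ∧ AnalyticAt ℝ c t ∧ f (c t) = (1 - t) * f p + t * f q

/-- A curve in `X` starting in an open set `U` stays in `U ∩ X` for small positive times. -/
lemma eventually_curve_mem {X U : Set E} (hU : IsOpen U) {c : ℝ → E} (h0 : c 0 ∈ U)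
    (hc : ∀ t ∈ Set.Icc (0 : ℝ) 1, c t ∈ X ∧ AnalyticAt ℝ c t) :
    ∀ᶠ t in 𝓝[>] (0 : ℝ), t ∈ Set.Ioo (0 : ℝ) 1 ∧ c t ∈ U ∩ X := by
  have hcont : ContinuousAt c 0 := (hc 0 (by simp)).2.continuousAt
  have h1 : ∀ᶠ t in 𝓝[>] (0 : ℝ), c t ∈ U :=
    (hcont.eventually_mem (hU.mem_nhds h0)).filter_mono nhdsWithin_le_nhds
  have h2 : ∀ᶠ t in 𝓝[>] (0 : ℝ), t ∈ Set.Ioo (0 : ℝ) 1 := Ioo_mem_nhdsGT one_pos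
  filter_upwards [h1, h2] with t ht ht'
  exact ⟨ht', ht, (hc t (Set.Ioo_subset_Icc_self ht')).1⟩

/-- If `f` and `g` are never strictly discordant on a relatively open piece of `X`, then
`g` is constant on the level sets of `f` in that piece. -/
lemma eq_of_eq_of_concordant_on_open {X U : Set E} {f g : E → ℝ} (hf : HasAffineCurves X f)
    (hg : ∀ x ∈ X, AnalyticAt ℝ g x) (hU : IsOpen U)
    (hnc : ∀ c, ∃ x ∈ X, f x ≠ c)
    (hcon : ∀ p ∈ U ∩ X, ∀ q ∈ U ∩ X, f p < f q → g p ≤ g q) {p q : E}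
    (hp : p ∈ U ∩ X) (hq : q ∈ U ∩ X) (hpq : f p = f q) : g p = g q := by
  wlog hlt : g q < g p generalizing p q
  · rcases lt_trichotomy (g p) (g q) with h | h | h
    · exact (this hq hp hpq.symm h).symm
    · exact h
    · exact absurd h hlt
  exfalso
  obtain ⟨x, hx, hxf⟩ := hnc (f p)
  have key : ∀ y ∈ U ∩ X, ∀ V : Set ℝ, IsOpen V → g y ∈ V → ∃ z ∈ U ∩ X, g z ∈ V ∧
      ∃ t : ℝ, 0 < t ∧ f z = (1 - t) * f y + t * f x := by
    intro y hy V hV hyV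
    obtain ⟨c, c0, -, hc⟩ := hf y hy.2 x hx
    have hev := eventually_curve_mem hU (c0 ▸ hy.1) fun t ht => ⟨(hc t ht).1, (hc t ht).2.1⟩
    have hcont : ContinuousAt (fun t => g (c t)) 0 :=
      ContinuousAt.comp (f := c) (g := g) (by rw [c0]; exact (hg y hy.2).continuousAt)
        (hc 0 (by simp)).2.1.continuousAt
    have hev' : ∀ᶠ t in 𝓝[>] (0 : ℝ), g (c t) ∈ V :=
      (hcont.eventually_mem (hV.mem_nhds (by simpa [c0] using hyV))).filter_mono
        nhdsWithin_le_nhds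
    obtain ⟨t, ⟨ht, htU⟩, htV⟩ := (hev.and hev').exists
    exact ⟨c t, htU, htV, t, ht.1, (hc t (Set.Ioo_subset_Icc_self ht)).2.2⟩
  rcases lt_or_gt_of_ne hxf with h | h
  · obtain ⟨z, hz, hzV, t, ht, hft⟩ := key p hp (Set.Ioi (g q)) isOpen_Ioi hlt
    have := hcon z hz q hq (by rw [hft, ← hpq]; nlinarith)
    exact absurd this (not_le.2 hzV)
  · obtain ⟨z, hz, hzV, t, ht, hft⟩ := key q hq (Set.Iio (g p)) isOpen_Iio hlt
    have := hcon p hp z hz (by rw [hft, ← hpq]; nlinarith)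
    exact absurd this (not_le.2 hzV)

/-- Local concordance propagates: `g` is constant on the level sets of `f` in all of `X`. -/
lemma eq_of_eq_of_concordant {X U : Set E} {f g : E → ℝ} (hf : HasAffineCurves X f)
    (hg : ∀ x ∈ X, AnalyticAt ℝ g x) (hU : IsOpen U) (hne : (U ∩ X).Nonempty)
    (hnc : ∀ c, ∃ x ∈ X, f x ≠ c)
    (hcon : ∀ p ∈ U ∩ X, ∀ q ∈ U ∩ X, f p < f q → g p ≤ g q) {p q : E}
    (hp : p ∈ X) (hq : q ∈ X) (hpq : f p = f q) : g p = g q := by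
  obtain ⟨x, hx⟩ := hne
  obtain ⟨c, c0, c1, hc⟩ := hf x hx.2 p hp
  obtain ⟨d, d0, d1, hd⟩ := hf x hx.2 q hq
  have hevc := eventually_curve_mem hU (c0 ▸ hx.1) fun t ht => ⟨(hc t ht).1, (hc t ht).2.1⟩
  have hevd := eventually_curve_mem hU (d0 ▸ hx.1) fun t ht => ⟨(hd t ht).1, (hd t ht).2.1⟩
  have hac : AnalyticOnNhd ℝ (fun t => g (c t)) (Set.Icc 0 1) := fun t ht =>
    AnalyticAt.comp (g := g) (f := c) (hg _ (hc t ht).1) (hc t ht).2.1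
  have had : AnalyticOnNhd ℝ (fun t => g (d t)) (Set.Icc 0 1) := fun t ht =>
    AnalyticAt.comp (g := g) (f := d) (hg _ (hd t ht).1) (hd t ht).2.1
  have hev : ∀ᶠ t in 𝓝[>] (0 : ℝ), g (c t) = g (d t) := by
    filter_upwards [hevc, hevd] with t htc htd
    have ht := Set.Ioo_subset_Icc_self htc.1
    refine eq_of_eq_of_concordant_on_open hf hg hU hnc hcon htc.2 htd.2 ?_
    rw [(hc t ht).2.2, (hd t ht).2.2, hpq]
  have hfr : ∃ᶠ t in 𝓝[≠] (0 : ℝ), g (c t) = g (d t) :=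
    hev.frequently.filter_mono (nhdsWithin_mono _ fun t ht => ne_of_gt ht)
  have := hac.eqOn_of_preconnected_of_frequently_eq had isPreconnected_Icc
    (by simp : (0 : ℝ) ∈ Set.Icc (0 : ℝ) 1) hfr (by simp : (1 : ℝ) ∈ Set.Icc (0 : ℝ) 1)
  simpa [c1, d1] using this

/-- Local concordance propagates to all of `X` when the level sets agree. -/
lemma le_of_lt_of_concordant {X U : Set E} {f g : E → ℝ} (hf : HasAffineCurves X f)
    (hg : ∀ x ∈ X, AnalyticAt ℝ g x) (hU : IsOpen U) (hne : (U ∩ X).Nonempty)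
    (hnc : ∀ c, ∃ x ∈ X, f x ≠ c)
    (hcon : ∀ p ∈ U ∩ X, ∀ q ∈ U ∩ X, f p < f q → g p ≤ g q)
    (heq : ∀ p ∈ X, ∀ q ∈ X, g p = g q → f p = f q) {p q : E}
    (hp : p ∈ X) (hq : q ∈ X) (hpq : f p < f q) : g p ≤ g q := by
  obtain ⟨u, hu, v, hv, huv⟩ : ∃ u ∈ U ∩ X, ∃ v ∈ U ∩ X, f u < f v := by
    obtain ⟨x, hx⟩ := hne
    obtain ⟨y, hy, hxy⟩ := hnc (f x)
    obtain ⟨c, c0, -, hc⟩ := hf x hx.2 y hy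
    have hev := eventually_curve_mem hU (c0 ▸ hx.1) fun t ht => ⟨(hc t ht).1, (hc t ht).2.1⟩
    obtain ⟨t, ht, htU⟩ := hev.exists
    have hft := (hc t (Set.Ioo_subset_Icc_self ht)).2.2
    rcases lt_or_gt_of_ne hxy with h | h
    · exact ⟨c t, htU, x, hx, by rw [hft]; nlinarith [ht.1]⟩
    · exact ⟨x, hx, c t, htU, by rw [hft]; nlinarith [ht.1]⟩
  obtain ⟨c, c0, c1, hc⟩ := hf u hu.2 p hp
  obtain ⟨d, d0, d1, hd⟩ := hf v hv.2 q hq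
  have hlt : ∀ t ∈ Set.Icc (0 : ℝ) 1, f (c t) < f (d t) := by
    intro t ht
    rw [(hc t ht).2.2, (hd t ht).2.2]
    rcases eq_or_lt_of_le ht.1 with h | h
    · simpa [← h] using huv
    · nlinarith [ht.2]
  have hcont : ContinuousOn (fun t => g (d t) - g (c t)) (Set.Icc 0 1) := by
    intro t ht
    refine ContinuousAt.continuousWithinAt (ContinuousAt.sub ?_ ?_)
    · exact (AnalyticAt.comp (g := g) (f := d) (hg _ (hd t ht).1) (hd t ht).2.1).continuousAt
    · exact (AnalyticAt.comp (g := g) (f := c) (hg _ (hc t ht).1) (hc t ht).2.1).continuousAt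
  by_contra hgt
  have h0 : 0 ≤ g (d 0) - g (c 0) := by
    rw [c0, d0]; linarith [hcon u hu v hv huv]
  have h1 : g (d 1) - g (c 1) ≤ 0 := by
    rw [c1, d1]; linarith
  obtain ⟨t, ht, h⟩ := isPreconnected_Icc.intermediate_value
    (by simp : (1 : ℝ) ∈ Set.Icc (0 : ℝ) 1) (by simp : (0 : ℝ) ∈ Set.Icc (0 : ℝ) 1)
    hcont ⟨h1, h0⟩
  have := heq _ (hc t ht).1 _ (hd t ht).1 (by simp only at h; linarith)
  exact absurd this (hlt t ht).ne

end Comonotone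

section Closure

variable {E : Type*} [TopologicalSpace E]

/-- Coincidence of level sets passes to the closure. -/
lemma eq_of_eq_of_mem_closure {X : Set E} {f g : E → ℝ} (hX : IsPreconnected X)
    (hg : ContinuousOn g X)
    (heq : ∀ p ∈ X, ∀ q ∈ X, f p = f q → g p = g q)
    (hle : ∀ p ∈ X, ∀ q ∈ X, f p < f q → g p ≤ g q) {y z : E}
    (hy : y ∈ closure X) (hz : z ∈ closure X)
    (hfy : ContinuousAt f y) (hfz : ContinuousAt f z)
    (hgy : ContinuousAt g y) (hgz : ContinuousAt g z) (hyz : f y = f z) : g y = g z := by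
  wlog hlt : g y < g z generalizing y z
  · rcases lt_trichotomy (g y) (g z) with h | h | h
    · exact absurd h hlt
    · exact h
    · exact (this hz hy hfz hfy hgz hgy hyz.symm h).symm
  exfalso
  have := mem_closure_iff_nhdsWithin_neBot.1 hy
  have := mem_closure_iff_nhdsWithin_neBot.1 hz
  have key : ∀ m, g y < m → m < g z → ∃ p ∈ X, g p = m ∧ f p = f y := by
    intro m h1 h2
    have ey : ∀ᶠ x in 𝓝[X] y, g x < m ∧ x ∈ X :=
      ((hgy.eventually_lt_const h1).filter_mono nhdsWithin_le_nhds).and self_mem_nhdsWithin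
    have ez : ∀ᶠ x in 𝓝[X] z, m < g x ∧ x ∈ X :=
      ((hgz.eventually_const_lt h2).filter_mono nhdsWithin_le_nhds).and self_mem_nhdsWithin
    obtain ⟨a, ha, haX⟩ := ey.exists
    obtain ⟨b, hb, hbX⟩ := ez.exists
    obtain ⟨p, hp, hpm⟩ := hX.intermediate_value haX hbX hg ⟨ha.le, hb.le⟩
    refine ⟨p, hp, hpm, le_antisymm ?_ ?_⟩
    · rw [hyz]
      refine ge_of_tendsto (hfz.mono_left nhdsWithin_le_nhds) (ez.mono fun x hx => ?_)
      by_contra h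
      linarith [hle x hx.2 p hp (not_le.1 h)]
    · refine le_of_tendsto (hfy.mono_left nhdsWithin_le_nhds) (ey.mono fun x hx => ?_)
      by_contra h
      linarith [hle p hp x hx.2 (not_le.1 h)]
  obtain ⟨m, hm1, hm2⟩ := exists_between hlt
  obtain ⟨n, hn1, hn2⟩ := exists_between hm2
  obtain ⟨p, hp, hpm, hpf⟩ := key m hm1 hm2
  obtain ⟨q, hq, hqn, hqf⟩ := key n (hm1.trans hn1) hn2
  have := heq p hp q hq (hpf.trans hqf.symm)
  linarith

/-- Order preservation passes to the closure. -/
lemma le_of_le_of_mem_closure {X : Set E} {f g : E → ℝ} (hX : IsPreconnected X)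
    (hg : ContinuousOn g X)
    (heq : ∀ p ∈ X, ∀ q ∈ X, f p = f q → g p = g q)
    (hle : ∀ p ∈ X, ∀ q ∈ X, f p < f q → g p ≤ g q) {y z : E}
    (hy : y ∈ closure X) (hz : z ∈ closure X)
    (hfy : ContinuousAt f y) (hfz : ContinuousAt f z)
    (hgy : ContinuousAt g y) (hgz : ContinuousAt g z) (hyz : f y ≤ f z) : g y ≤ g z := by
  rcases hyz.eq_or_lt with h | h
  · exact (eq_of_eq_of_mem_closure hX hg heq hle hy hz hfy hfz hgy hgz h).le
  have := mem_closure_iff_nhdsWithin_neBot.1 hy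
  have := mem_closure_iff_nhdsWithin_neBot.1 hz
  by_contra hgt
  obtain ⟨m, hm1, hm2⟩ := exists_between h
  obtain ⟨n, hn1, hn2⟩ := exists_between (not_le.1 hgt)
  have ey : ∀ᶠ x in 𝓝[X] y, (f x < m ∧ n < g x) ∧ x ∈ X :=
    (((hfy.eventually_lt_const hm1).and (hgy.eventually_const_lt hn2)).filter_mono
      nhdsWithin_le_nhds).and self_mem_nhdsWithin
  have ez : ∀ᶠ x in 𝓝[X] z, (m < f x ∧ g x < n) ∧ x ∈ X :=
    (((hfz.eventually_const_lt hm2).and (hgz.eventually_lt_const hn1)).filter_mono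
      nhdsWithin_le_nhds).and self_mem_nhdsWithin
  obtain ⟨a, ⟨ha1, ha2⟩, haX⟩ := ey.exists
  obtain ⟨b, ⟨hb1, hb2⟩, hbX⟩ := ez.exists
  linarith [hle a haX b hbX (ha1.trans hb1)]

/-- A function that is not constant on the closure of `X` is not constant on `X`. -/
lemma exists_ne_of_ne_of_mem_closure {X : Set E} {f : E → ℝ} {y z : E}
    (hy : y ∈ closure X) (hz : z ∈ closure X)
    (hfy : ContinuousAt f y) (hfz : ContinuousAt f z) (hyz : f y ≠ f z) (c : ℝ) :
    ∃ x ∈ X, f x ≠ c := by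
  by_contra! h
  have key : ∀ w ∈ closure X, ContinuousAt f w → f w = c := by
    intro w hw hfw
    have := mem_closure_iff_nhdsWithin_neBot.1 hw
    refine tendsto_nhds_unique (hfw.mono_left (nhdsWithin_le_nhds (s := X)))
      (tendsto_const_nhds.congr' ?_)
    filter_upwards [self_mem_nhdsWithin] with x hx using (h x hx).symm
  exact hyz ((key y hy hfy).trans (key z hz hfz).symm)

end Closure

section Policies

variable {S A : Type*} [Fintype A]

lemma convex_piPlus : Convex ℝ (PiPlus : Set (S → A → ℝ)) := by
  intro p hp q hq a b ha hb hab
  have hpos : ∀ s x, 0 < (a • p + b • q) s x := by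
    intro s x
    have h1 := hp.2 s x
    have h2 := hq.2 s x
    simp only [Pi.add_apply, Pi.smul_apply, smul_eq_mul]
    rcases ha.eq_or_lt with h | h
    · have : b = 1 := by linarith
      simpa [← h, this] using h2
    · nlinarith [mul_pos h h1, mul_nonneg hb h2.le]
  refine ⟨fun s => ⟨fun x => (hpos s x).le, ?_⟩, hpos⟩
  simp only [Pi.add_apply, Pi.smul_apply, smul_eq_mul, Finset.sum_add_distrib,
    ← Finset.mul_sum, (hp.1 s).2, (hq.1 s).2]
  linarith

lemma IsPolicy.mem_closure_piPlus {p q : S → A → ℝ} (hp : IsPolicy p) (hq : q ∈ PiPlus) :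
    p ∈ closure (PiPlus : Set (S → A → ℝ)) := by
  have hcont : Continuous fun t : ℝ => (1 - t) • p + t • q := by fun_prop
  have ht : Tendsto (fun t : ℝ => (1 - t) • p + t • q) (𝓝[>] 0) (𝓝 p) := by
    have := (hcont.tendsto 0).mono_left (nhdsWithin_le_nhds (s := Set.Ioi 0))
    simpa using this
  refine mem_closure_of_tendsto ht ?_
  filter_upwards [Ioo_mem_nhdsGT (one_pos : (0 : ℝ) < 1)] with t ht
  have hpos : ∀ s x, 0 < ((1 - t) • p + t • q) s x := by
    intro s x
    simp only [Pi.add_apply, Pi.smul_apply, smul_eq_mul]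
    nlinarith [mul_pos ht.1 (hq.2 s x), mul_nonneg (sub_nonneg.2 ht.2.le) ((hp s).1 x)]
  refine ⟨fun s => ⟨fun x => (hpos s x).le, ?_⟩, hpos⟩
  simp only [Pi.add_apply, Pi.smul_apply, smul_eq_mul, Finset.sum_add_distrib,
    ← Finset.mul_sum, (hp s).2, (hq.1 s).2]
  linarith

variable [Fintype S]

lemma Pmat_nonneg {T : S → A → S → ℝ} (hT : IsTransModel T) {p : S → A → ℝ}
    (hp : IsPolicy p) (s s' : S) : 0 ≤ Pmat T p s s' :=
  Finset.sum_nonneg fun a _ => mul_nonneg ((hp s).1 a) ((hT s a).1 s')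

lemma sum_Pmat {T : S → A → S → ℝ} (hT : IsTransModel T) {p : S → A → ℝ}
    (hp : IsPolicy p) (s : S) : ∑ s', Pmat T p s s' = 1 := by
  simp only [Pmat, Matrix.of_apply]
  rw [Finset.sum_comm]
  simp [← Finset.mul_sum, (hT s _).2, (hp s).2]

/-- `m` solves the discounted flow equation of the policy `p`. -/
def IsFlow (T : S → A → S → ℝ) (d0 : S → ℝ) (γ : ℝ) (p : S → A → ℝ) (m : S → ℝ) : Prop :=
  ∀ s', m s' = d0 s' + γ * ∑ s, m s * Pmat T p s s'

lemma IsFlow.nonneg {T : S → A → S → ℝ} (hT : IsTransModel T) {d0 : S → ℝ} (hd0 : IsDist d0)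
    {γ : ℝ} (hγ0 : 0 ≤ γ) (hγ1 : γ < 1) {p : S → A → ℝ} (hp : IsPolicy p) {m : S → ℝ}
    (hm : IsFlow T d0 γ p m) (s : S) : 0 ≤ m s := by
  have hn : ∀ s', max (-m s') 0 ≤ γ * ∑ s, max (-m s) 0 * Pmat T p s s' := by
    intro s'
    have h0 : 0 ≤ ∑ s, max (-m s) 0 * Pmat T p s s' :=
      Finset.sum_nonneg fun s _ => mul_nonneg (le_max_right _ _) (Pmat_nonneg hT hp s s')
    have h1 : ∑ s, -m s * Pmat T p s s' ≤ ∑ s, max (-m s) 0 * Pmat T p s s' :=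
      Finset.sum_le_sum fun s _ =>
        mul_le_mul_of_nonneg_right (le_max_left _ _) (Pmat_nonneg hT hp s s')
    refine max_le ?_ (mul_nonneg hγ0 h0)
    have h2 := mul_le_mul_of_nonneg_left h1 hγ0
    simp only [neg_mul, Finset.sum_neg_distrib] at h2
    linarith [hm s', hd0.1 s']
  have hsum : ∑ s', max (-m s') 0 ≤ γ * ∑ s, max (-m s) 0 := by
    calc ∑ s', max (-m s') 0 ≤ ∑ s', γ * ∑ s, max (-m s) 0 * Pmat T p s s' :=
          Finset.sum_le_sum fun s' _ => hn s'
      _ = γ * ∑ s, max (-m s) 0 := by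
          rw [← Finset.mul_sum, Finset.sum_comm]
          simp [← Finset.mul_sum, sum_Pmat hT hp]
  have hle : max (-m s) 0 ≤ ∑ s, max (-m s) 0 :=
    Finset.single_le_sum (f := fun s => max (-m s) 0) (fun s _ => le_max_right _ _)
      (Finset.mem_univ s)
  have : ∑ s, max (-m s) 0 ≤ 0 := by nlinarith
  linarith [le_max_left (-m s) 0]

/-- Fully mixed policies visit the same states. -/
lemma IsFlow.eq_zero_of_eq_zero {T : S → A → S → ℝ} (hT : IsTransModel T) {d0 : S → ℝ}
    (hd0 : IsDist d0) {γ : ℝ} (hγ0 : 0 ≤ γ) (hγ1 : γ < 1) {p q : S → A → ℝ}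
    (hp : p ∈ PiPlus) (hq : IsPolicy q) {m n : S → ℝ}
    (hm : IsFlow T d0 γ p m) (hn : IsFlow T d0 γ q n) {s : S} (hs : m s = 0) : n s = 0 := by
  classical
  have hm0 := hm.nonneg hT hd0 hγ0 hγ1 hp.1
  have hn0 := hn.nonneg hT hd0 hγ0 hγ1 hq
  set Z : Finset S := Finset.univ.filter fun s => m s = 0 with hZ
  have hterm : ∀ s' ∈ Z, d0 s' = 0 ∧ ∀ s, s ∉ Z → γ * Pmat T q s s' = 0 := by
    intro s' hs'
    have hs' : m s' = 0 := by simpa [hZ] using hs'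
    have hnn : ∀ s ∈ Finset.univ, 0 ≤ m s * Pmat T p s s' := fun s _ =>
      mul_nonneg (hm0 s) (Pmat_nonneg hT hp.1 s s')
    have h0 := mul_nonneg hγ0 (Finset.sum_nonneg hnn)
    have h1 := hm s'
    rw [hs'] at h1
    refine ⟨by linarith [hd0.1 s'], fun s hsZ => ?_⟩
    have hms : m s ≠ 0 := by simpa [hZ] using hsZ
    have h2 : γ * ∑ s, m s * Pmat T p s s' = 0 := by linarith [hd0.1 s']
    rcases mul_eq_zero.1 h2 with h | h
    · simp [h]
    · have h3 := (Finset.sum_eq_zero_iff_of_nonneg hnn).1 h s (Finset.mem_univ s)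
      have h4 : ∑ a, p s a * T s a s' = 0 := (mul_eq_zero.1 h3).resolve_left hms
      have h5 := (Finset.sum_eq_zero_iff_of_nonneg fun a _ =>
        mul_nonneg (hp.2 s a).le ((hT s a).1 s')).1 h4
      have h6 : Pmat T q s s' = 0 := by
        simp only [Pmat, Matrix.of_apply]
        refine Finset.sum_eq_zero fun a _ => ?_
        rw [(mul_eq_zero.1 (h5 a (Finset.mem_univ a))).resolve_left (hp.2 s a).ne', mul_zero]
      simp [h6]
  have hle : ∑ s' ∈ Z, n s' ≤ γ * ∑ s ∈ Z, n s := by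
    calc ∑ s' ∈ Z, n s' = ∑ s' ∈ Z, ∑ s ∈ Z, γ * (n s * Pmat T q s s') := by
          refine Finset.sum_congr rfl fun s' hs' => ?_
          rw [hn s', (hterm s' hs').1, zero_add, Finset.mul_sum]
          refine (Finset.sum_subset (Finset.subset_univ Z) fun s _ hsZ => ?_).symm
          linear_combination n s * (hterm s' hs').2 s hsZ
      _ = γ * ∑ s ∈ Z, n s * ∑ s' ∈ Z, Pmat T q s s' := by
          rw [Finset.sum_comm]
          simp only [Finset.mul_sum]
      _ ≤ γ * ∑ s ∈ Z, n s := by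
          refine mul_le_mul_of_nonneg_left (Finset.sum_le_sum fun s _ => ?_) hγ0
          refine mul_le_of_le_one_right (hn0 s) ?_
          rw [← sum_Pmat hT hq s]
          exact Finset.sum_le_sum_of_subset_of_nonneg (Finset.subset_univ Z)
            fun s' _ _ => Pmat_nonneg hT hq s s'
  have hsZ : s ∈ Z := by simpa [hZ] using hs
  have hsingle : n s ≤ ∑ s ∈ Z, n s := Finset.single_le_sum (fun s _ => hn0 s) hsZ
  nlinarith [hn0 s]

lemma analyticAt_eval (s : S) (a : A) (p : S → A → ℝ) :
    AnalyticAt ℝ (fun q : S → A → ℝ => q s a) p :=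
  ((ContinuousLinearMap.proj a).comp
    (ContinuousLinearMap.proj s : (S → A → ℝ) →L[ℝ] A → ℝ)).analyticAt p

variable [DecidableEq S]

lemma det_one_sub_ne_zero {T : S → A → S → ℝ} (hT : IsTransModel T) {γ : ℝ}
    (hγ0 : 0 ≤ γ) (hγ1 : γ < 1) {p : S → A → ℝ} (hp : IsPolicy p) :
    ((1 : Matrix S S ℝ) - γ • Pmat T p).det ≠ 0 := by
  refine det_ne_zero_of_sum_row_lt_diag fun k => ?_
  have hsum := sum_Pmat hT hp k
  rw [← Finset.add_sum_erase _ _ (Finset.mem_univ k)] at hsum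
  have hoff : ∑ j ∈ Finset.univ.erase k, ‖((1 : Matrix S S ℝ) - γ • Pmat T p) k j‖
      = γ * ∑ j ∈ Finset.univ.erase k, Pmat T p k j := by
    rw [Finset.mul_sum]
    refine Finset.sum_congr rfl fun j hj => ?_
    have hjk : k ≠ j := (Finset.ne_of_mem_erase hj).symm
    simp [Matrix.one_apply_ne hjk, abs_of_nonneg hγ0, abs_of_nonneg (Pmat_nonneg hT hp k j)]
  rw [hoff]
  refine lt_of_lt_of_le ?_ (le_abs_self _)
  simp only [Matrix.sub_apply, Matrix.one_apply_eq, Matrix.smul_apply, smul_eq_mul]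
  have : γ * (Pmat T p k k + ∑ j ∈ Finset.univ.erase k, Pmat T p k j) = γ := by
    rw [hsum, mul_one]
  linarith

lemma isFlow_iff {T : S → A → S → ℝ} {d0 : S → ℝ} {γ : ℝ} {p : S → A → ℝ} {m : S → ℝ} :
    IsFlow T d0 γ p m ↔ m ᵥ* ((1 : Matrix S S ℝ) - γ • Pmat T p) = d0 := by
  rw [funext_iff]
  refine forall_congr' fun s' => ?_
  have : (m ᵥ* ((1 : Matrix S S ℝ) - γ • Pmat T p)) s'
      = m s' - γ * ∑ s, m s * Pmat T p s s' := by
    rw [Matrix.vecMul_sub, Matrix.vecMul_one, Matrix.vecMul_smul]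
    simp [Matrix.vecMul, dotProduct]
  rw [this, sub_eq_iff_eq_add]

lemma exists_isFlow {T : S → A → S → ℝ} (hT : IsTransModel T) (d0 : S → ℝ) {γ : ℝ}
    (hγ0 : 0 ≤ γ) (hγ1 : γ < 1) {p : S → A → ℝ} (hp : IsPolicy p) :
    ∃ m, IsFlow T d0 γ p m := by
  refine ⟨d0 ᵥ* ((1 : Matrix S S ℝ) - γ • Pmat T p)⁻¹, isFlow_iff.2 ?_⟩
  rw [Matrix.vecMul_vecMul,
    Matrix.nonsing_inv_mul _ (det_one_sub_ne_zero hT hγ0 hγ1 hp).isUnit, Matrix.vecMul_one]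

/-- The value of a policy is the reward weighted by its discounted visits. -/
lemma IsFlow.Jval_eq {T : S → A → S → ℝ} (hT : IsTransModel T) (R : S → A → ℝ) {d0 : S → ℝ}
    {γ : ℝ} (hγ0 : 0 ≤ γ) (hγ1 : γ < 1) {p : S → A → ℝ} (hp : IsPolicy p) {m : S → ℝ}
    (hm : IsFlow T d0 γ p m) : Jval T R d0 γ p = ∑ s, ∑ a, m s * p s a * R s a := by
  have h := isFlow_iff.1 hm
  change d0 ⬝ᵥ (((1 : Matrix S S ℝ) - γ • Pmat T p)⁻¹ *ᵥ rvec R p) = _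
  rw [← h, Matrix.dotProduct_mulVec, Matrix.vecMul_vecMul,
    Matrix.mul_nonsing_inv _ (det_one_sub_ne_zero hT hγ0 hγ1 hp).isUnit, Matrix.vecMul_one]
  simp [dotProduct, rvec, Finset.mul_sum, mul_assoc]

lemma analyticAt_det {E : Type*} [NormedAddCommGroup E] [NormedSpace ℝ E]
    {M : E → Matrix S S ℝ} {x : E} (hM : ∀ i j, AnalyticAt ℝ (fun y => M y i j) x) :
    AnalyticAt ℝ (fun y => (M y).det) x := by
  simp only [Matrix.det_apply']
  exact Finset.analyticAt_fun_sum _ fun σ _ =>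
    analyticAt_const.mul (Finset.analyticAt_fun_prod _ fun i _ => hM _ _)

lemma analyticAt_Jval {T : S → A → S → ℝ} (hT : IsTransModel T) (R : S → A → ℝ) (d0 : S → ℝ)
    {γ : ℝ} (hγ0 : 0 ≤ γ) (hγ1 : γ < 1) {p : S → A → ℝ} (hp : IsPolicy p) :
    AnalyticAt ℝ (Jval T R d0 γ) p := by
  have hM : ∀ i j, AnalyticAt ℝ
      (fun q : S → A → ℝ => ((1 : Matrix S S ℝ) - γ • Pmat T q) i j) p := by
    intro i j
    simp only [Matrix.sub_apply, Matrix.smul_apply, smul_eq_mul, Pmat, Matrix.of_apply]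
    exact analyticAt_const.sub (analyticAt_const.mul
      (Finset.analyticAt_fun_sum _ fun a _ => (analyticAt_eval i a p).mul analyticAt_const))
  have hinv : ∀ i j, AnalyticAt ℝ
      (fun q : S → A → ℝ => ((1 : Matrix S S ℝ) - γ • Pmat T q)⁻¹ i j) p := by
    intro i j
    simp only [Matrix.inv_def, Matrix.smul_apply, smul_eq_mul, Ring.inverse_eq_inv',
      Matrix.adjugate_apply]
    refine ((analyticAt_det hM).inv (det_one_sub_ne_zero hT hγ0 hγ1 hp)).mul
      (analyticAt_det fun k l => ?_)
    by_cases hk : k = j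
    · subst hk
      simp only [Matrix.updateRow_self]
      exact analyticAt_const
    · simp only [Matrix.updateRow_ne hk]
      exact hM k l
  unfold Jval
  simp only [Matrix.mulVec, dotProduct, rvec]
  exact Finset.analyticAt_fun_sum _ fun s _ => analyticAt_const.mul
    (Finset.analyticAt_fun_sum _ fun s' _ => (hinv s s').mul
      (Finset.analyticAt_fun_sum _ fun a _ => (analyticAt_eval s' a p).mul analyticAt_const))

/-- Mixing visit counts yields curves of fully mixed policies with affine value. -/
lemma hasAffineCurves_Jval {T : S → A → S → ℝ} (hT : IsTransModel T) (R : S → A → ℝ)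
    {d0 : S → ℝ} (hd0 : IsDist d0) {γ : ℝ} (hγ0 : 0 ≤ γ) (hγ1 : γ < 1) :
    HasAffineCurves (PiPlus : Set (S → A → ℝ)) (Jval T R d0 γ) := by
  intro p hp q hq
  obtain ⟨m, hm⟩ := exists_isFlow hT d0 hγ0 hγ1 hp.1
  obtain ⟨n, hn⟩ := exists_isFlow hT d0 hγ0 hγ1 hq.1
  have hm0 := hm.nonneg hT hd0 hγ0 hγ1 hp.1
  have hn0 := hn.nonneg hT hd0 hγ0 hγ1 hq.1
  obtain ⟨v, w, hv, hw, hvw⟩ : ∃ v w : S → ℝ, (∀ s, 0 < v s) ∧ (∀ s, 0 < w s) ∧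
      ∀ s, (m s = 0 ∧ n s = 0) ∨ (v s = m s ∧ w s = n s) := by
    refine ⟨fun s => if m s = 0 then 1 else m s, fun s => if n s = 0 then 1 else n s,
      fun s => ?_, fun s => ?_, fun s => ?_⟩
    · dsimp only
      split_ifs with h
      exacts [one_pos, (hm0 s).lt_of_ne' h]
    · dsimp only
      split_ifs with h
      exacts [one_pos, (hn0 s).lt_of_ne' h]
    · by_cases h : m s = 0
      · exact Or.inl ⟨h, hm.eq_zero_of_eq_zero hT hd0 hγ0 hγ1 hp hq.1 hn h⟩
      · have h' : n s ≠ 0 := fun h' =>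
          h (hn.eq_zero_of_eq_zero hT hd0 hγ0 hγ1 hq hp.1 hm h')
        exact Or.inr ⟨if_neg h, if_neg h'⟩
  let c : ℝ → S → A → ℝ := fun t s a =>
    ((1 - t) * v s * p s a + t * w s * q s a) / ((1 - t) * v s + t * w s)
  have hden : ∀ t ∈ Set.Icc (0 : ℝ) 1, ∀ x y : ℝ, 0 < x → 0 < y →
      0 < (1 - t) * x + t * y := by
    intro t ht x y hx hy
    rcases ht.1.eq_or_lt with h | h
    · simpa [← h] using hx
    · linarith [mul_pos h hy, mul_nonneg (sub_nonneg.2 ht.2) hx.le]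
  refine ⟨c, ?_, ?_, fun t ht => ?_⟩
  · funext s a
    simp [c, (hv s).ne']
  · funext s a
    simp [c, (hw s).ne']
  have hdt := fun s => hden t ht (v s) (w s) (hv s) (hw s)
  have hpos : ∀ s a, 0 < c t s a := by
    intro s a
    refine div_pos ?_ (hdt s)
    have := hden t ht _ _ (mul_pos (hv s) (hp.2 s a)) (mul_pos (hw s) (hq.2 s a))
    linarith
  have hct : c t ∈ PiPlus := by
    refine ⟨fun s => ⟨fun a => (hpos s a).le, ?_⟩, hpos⟩
    simp only [c]
    rw [← Finset.sum_div, Finset.sum_add_distrib, ← Finset.mul_sum, ← Finset.mul_sum,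
      (hp.1 s).2, (hq.1 s).2, mul_one, mul_one, div_self (hdt s).ne']
  have hmix : ∀ s a, ((1 - t) * m s + t * n s) * c t s a
      = (1 - t) * (m s * p s a) + t * (n s * q s a) := by
    intro s a
    rcases hvw s with ⟨h1, h2⟩ | ⟨h1, h2⟩
    · simp [h1, h2]
    · rw [← h1, ← h2]
      simp only [c]
      rw [mul_div_cancel₀ _ (hdt s).ne']
      ring
  have hflow : IsFlow T d0 γ (c t) fun s => (1 - t) * m s + t * n s := by
    intro s'
    have : ∑ s, ((1 - t) * m s + t * n s) * Pmat T (c t) s s'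
        = (1 - t) * ∑ s, m s * Pmat T p s s' + t * ∑ s, n s * Pmat T q s s' := by
      rw [Finset.mul_sum, Finset.mul_sum, ← Finset.sum_add_distrib]
      refine Finset.sum_congr rfl fun s _ => ?_
      simp only [Pmat, Matrix.of_apply, Finset.mul_sum]
      rw [← Finset.sum_add_distrib]
      refine Finset.sum_congr rfl fun a _ => ?_
      linear_combination T s a s' * hmix s a
    rw [this]
    linear_combination (1 - t) * hm s' + t * hn s'
  refine ⟨hct, ?_, ?_⟩
  · refine analyticAt_pi_iff.2 fun s => analyticAt_pi_iff.2 fun a => ?_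
    refine AnalyticAt.div ?_ ?_ (hdt s).ne'
    · fun_prop
    · fun_prop
  · rw [hflow.Jval_eq hT R hγ0 hγ1 hct.1, hm.Jval_eq hT R hγ0 hγ1 hp.1,
      hn.Jval_eq hT R hγ0 hγ1 hq.1, Finset.mul_sum, Finset.mul_sum, ← Finset.sum_add_distrib]
    refine Finset.sum_congr rfl fun s _ => ?_
    rw [Finset.mul_sum, Finset.mul_sum, ← Finset.sum_add_distrib]
    refine Finset.sum_congr rfl fun a _ => ?_
    linear_combination R s a * hmix s a

end Policies

/-- **Imperfect world models are exploitable**: on any policy set containing a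
nonempty subset open in `Π⁺`, every non-trivial, non-equivalent pair of
transition models is exploitable. -/
theorem stmt9 {S A : Type*} [Fintype S] [Fintype A] [DecidableEq S] [Nonempty S]
    (hA : 1 < Fintype.card A)
    (d0 : S → ℝ) (hd0 : IsDist d0) (R : S → A → ℝ)
    (γ : ℝ) (hγ0 : 0 ≤ γ) (hγ1 : γ < 1)
    (T T' : S → A → S → ℝ) (hT : IsTransModel T) (hT' : IsTransModel T')
    (Ps : Set (S → A → ℝ)) (hPs : ∀ p ∈ Ps, IsPolicy p)
    -- `Ps` contains a nonempty subset open in `Π⁺`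
    (hopen : ∃ Pt : Set (S → A → ℝ), Pt ⊆ Ps ∧ Pt.Nonempty ∧
      ∃ U : Set (S → A → ℝ), IsOpen U ∧ Pt = U ∩ PiPlus)
    -- `J_T` is non-constant on `Ps`
    (hnc : ∃ π ∈ Ps, ∃ π' ∈ Ps, Jval T R d0 γ π ≠ Jval T R d0 γ π')
    -- `J_{T'}` is non-constant on `Ps`
    (hnc' : ∃ π ∈ Ps, ∃ π' ∈ Ps, Jval T' R d0 γ π ≠ Jval T' R d0 γ π')
    -- `J_T` and `J_{T'}` do not induce the same ordering on `Ps`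
    (hneq : ¬ ∀ π ∈ Ps, ∀ π' ∈ Ps,
      (Jval T R d0 γ π' ≤ Jval T R d0 γ π ↔
        Jval T' R d0 γ π' ≤ Jval T' R d0 γ π)) :
    ∃ π ∈ Ps, ∃ π' ∈ Ps,
      Jval T R d0 γ π' < Jval T R d0 γ π ∧
      Jval T' R d0 γ π < Jval T' R d0 γ π' := by
  by_contra! hcon
  obtain ⟨_, hsub, hne, U, hU, rfl⟩ := hopen
  have hcl : ∀ p ∈ Ps, p ∈ closure (PiPlus : Set (S → A → ℝ)) := fun p hp =>
    (hPs p hp).mem_closure_piPlus hne.some_mem.2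
  have han : ∀ p, IsPolicy p → AnalyticAt ℝ (Jval T R d0 γ) p := fun p hp =>
    analyticAt_Jval hT R d0 hγ0 hγ1 hp
  have han' : ∀ p, IsPolicy p → AnalyticAt ℝ (Jval T' R d0 γ) p := fun p hp =>
    analyticAt_Jval hT' R d0 hγ0 hγ1 hp
  have hco : ∀ p ∈ Ps, ContinuousAt (Jval T R d0 γ) p := fun p hp =>
    (han p (hPs p hp)).continuousAt
  have hco' : ∀ p ∈ Ps, ContinuousAt (Jval T' R d0 γ) p := fun p hp =>
    (han' p (hPs p hp)).continuousAt
  have hcv := hasAffineCurves_Jval hT R hd0 hγ0 hγ1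
  have hcv' := hasAffineCurves_Jval hT' R hd0 hγ0 hγ1
  obtain ⟨y, hy, z, hz, hyz⟩ := hnc
  obtain ⟨y', hy', z', hz', hyz'⟩ := hnc'
  have hX := exists_ne_of_ne_of_mem_closure (hcl y hy) (hcl z hz) (hco y hy) (hco z hz) hyz
  have hX' := exists_ne_of_ne_of_mem_closure (hcl y' hy') (hcl z' hz') (hco' y' hy')
    (hco' z' hz') hyz'
  have hcon₁ : ∀ p ∈ U ∩ PiPlus, ∀ q ∈ U ∩ PiPlus,
      Jval T R d0 γ p < Jval T R d0 γ q → Jval T' R d0 γ p ≤ Jval T' R d0 γ q :=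
    fun p hp q hq h => hcon q (hsub hq) p (hsub hp) h
  have hcon₂ : ∀ p ∈ U ∩ PiPlus, ∀ q ∈ U ∩ PiPlus,
      Jval T' R d0 γ p < Jval T' R d0 γ q → Jval T R d0 γ p ≤ Jval T R d0 γ q :=
    fun p hp q hq h => not_lt.1 fun h' => (hcon₁ q hq p hp h').not_gt h
  have heq₁ : ∀ p ∈ PiPlus, ∀ q ∈ PiPlus,
      Jval T R d0 γ p = Jval T R d0 γ q → Jval T' R d0 γ p = Jval T' R d0 γ q :=
    fun p hp q hq h =>
      eq_of_eq_of_concordant hcv (fun x hx => han' x hx.1) hU hne hX hcon₁ hp hq h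
  have heq₂ : ∀ p ∈ PiPlus, ∀ q ∈ PiPlus,
      Jval T' R d0 γ p = Jval T' R d0 γ q → Jval T R d0 γ p = Jval T R d0 γ q :=
    fun p hp q hq h =>
      eq_of_eq_of_concordant hcv' (fun x hx => han x hx.1) hU hne hX' hcon₂ hp hq h
  have hle₁ : ∀ p ∈ PiPlus, ∀ q ∈ PiPlus,
      Jval T R d0 γ p < Jval T R d0 γ q → Jval T' R d0 γ p ≤ Jval T' R d0 γ q :=
    fun p hp q hq h =>
      le_of_lt_of_concordant hcv (fun x hx => han' x hx.1) hU hne hX hcon₁ heq₂ hp hq h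
  have hle₂ : ∀ p ∈ PiPlus, ∀ q ∈ PiPlus,
      Jval T' R d0 γ p < Jval T' R d0 γ q → Jval T R d0 γ p ≤ Jval T R d0 γ q :=
    fun p hp q hq h =>
      le_of_lt_of_concordant hcv' (fun x hx => han x hx.1) hU hne hX' hcon₂ heq₁ hp hq h
  have hconn : IsPreconnected (PiPlus : Set (S → A → ℝ)) := convex_piPlus.isPreconnected
  refine hneq fun p hp q hq => ⟨fun h => ?_, fun h => ?_⟩
  · exact le_of_le_of_mem_closure hconn
      (fun x hx => (han' x hx.1).continuousAt.continuousWithinAt) heq₁ hle₁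
      (hcl q hq) (hcl p hp) (hco q hq) (hco p hp) (hco' q hq) (hco' p hp) h
  · exact le_of_le_of_mem_closure hconn
      (fun x hx => (han x hx.1).continuousAt.continuousWithinAt) heq₂ hle₂
      (hcl q hq) (hcl p hp) (hco' q hq) (hco' p hp) (hco q hq) (hco p hp) h
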